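/- Let x₀ ∈ ℝ, δ' > 0, and let f : ℂ → ℂ be complex-differentiable on the open ball B(x₀, δ') ⊆ ℂ, with f(x) ∈ ℝ for every real x ∈ B(x₀, δ'), f(x₀) = 0, and f'(x₀) a positive real number. Then there exists δ with 0 < δ ≤ δ' such that for every z ∈ B(x₀, δ): if Im z > 0 then Im f(z) > 0, and if Im z < 0 then Im f(z) < 0. -/

import Mathlib

open Complex Metric

/-- If `f` is complex-differentiable on the ball `B(x₀, δ')` centered at a
real point, real-valued on the real points of that ball, vanishes at `x₀`, and has a positive
real derivative there, then on some smaller ball it maps the upper half-plane into the upper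
half-plane and the lower half-plane into the lower half-plane. -/
theorem stmt_0 (x₀ δ' : ℝ) (hδ' : 0 < δ') (f : ℂ → ℂ)
    (hf : DifferentiableOn ℂ f (ball (x₀ : ℂ) δ'))
    (hreal : ∀ x : ℝ, (x : ℂ) ∈ ball (x₀ : ℂ) δ' → (f x).im = 0)
    (h0 : f x₀ = 0)
    (hderiv_re : (deriv f x₀).im = 0) (hderiv_pos : 0 < (deriv f x₀).re) :
    ∃ δ : ℝ, 0 < δ ∧ δ ≤ δ' ∧ ∀ z ∈ ball (x₀ : ℂ) δ,
      (0 < z.im → 0 < (f z).im) ∧ (z.im < 0 → (f z).im < 0) := by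
  have hs : HasStrictDerivAt f (deriv f x₀) x₀ :=
    (hf.analyticAt (ball_mem_nhds _ hδ')).hasStrictDerivAt
  have hev := hs.hasStrictFDerivAt.isLittleO.def (half_pos hderiv_pos)
  obtain ⟨ε, hε, hball⟩ := Metric.eventually_nhds_iff.1 hev
  refine ⟨min ε δ', lt_min hε hδ', min_le_right _ _, fun z hz => ?_⟩
  have hre : dist ((z.re : ℝ) : ℂ) x₀ ≤ dist z x₀ := by
    rw [Complex.dist_eq, Complex.dist_eq, ← ofReal_sub, norm_real, Real.norm_eq_abs]
    simpa using abs_re_le_norm (z - x₀)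
  rw [mem_ball, lt_min_iff] at hz
  have hx := hreal z.re (mem_ball.2 (hre.trans_lt hz.2))
  have hb := @hball (z, ((z.re : ℝ) : ℂ)) (by
    rw [Prod.dist_eq]
    exact max_lt hz.1 (hre.trans_lt hz.1))
  have hsub : z - ((z.re : ℝ) : ℂ) = z.im * I := by
    apply Complex.ext <;> simp
  have him := (abs_im_le_norm _).trans hb
  simp only [hsub] at him
  simp [hx, hderiv_re] at him
  rw [abs_le] at him
  constructor
  · intro h
    rw [abs_of_pos h] at him
    nlinarith [him.1, mul_pos h hderiv_pos]
  · intro h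
    rw [abs_of_neg h] at him
    nlinarith [him.2, mul_pos (neg_pos.2 h) hderiv_pos]
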